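/- arXiv:2507.02461 — 6 statements merged into one kernel-verified Lean document; each statement's English description precedes it below -/
import Mathlib

section
/- If the identity matrix I_n together with A_1, …, A_m are linearly independent in the space of symmetric n×n real matrices, then the log-partition function f is strictly convex on ℝ^m. -/
open Matrix Filter
open scoped RealInnerProductSpace

/-- `A(y) = ∑ i, y i • A i`. -/
noncomputable def matA {n m : ℕ} (A : Fin m → Matrix (Fin n) (Fin n) ℝ)
    (y : EuclideanSpace ℝ (Fin m)) : Matrix (Fin n) (Fin n) ℝ :=
  ∑ i, y i • A i

/-- The log-partition function `f(y) = log tr exp A(y) - ⟨b, y⟩`. -/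
noncomputable def logPart {n m : ℕ} (A : Fin m → Matrix (Fin n) (Fin n) ℝ)
    (b : EuclideanSpace ℝ (Fin m)) (y : EuclideanSpace ℝ (Fin m)) : ℝ :=
  Real.log (Matrix.trace (NormedSpace.exp (matA A y))) - ⟪b, y⟫

/-- The linear map `𝒜(X) = (tr(A i * X))_i`. -/
noncomputable def Amap {n m : ℕ} (A : Fin m → Matrix (Fin n) (Fin n) ℝ)
    (X : Matrix (Fin n) (Fin n) ℝ) : EuclideanSpace ℝ (Fin m) :=
  WithLp.toLp 2 fun i => Matrix.trace (A i * X)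

/-- The spectraplex: symmetric PSD matrices of unit trace. -/
def spectraplex (n : ℕ) : Set (Matrix (Fin n) (Fin n) ℝ) :=
  {X | X.IsSymm ∧ X.PosSemidef ∧ X.trace = 1}

/-- The moment body `ℳ = 𝒜(spectraplex)`. -/
noncomputable def momentBody {n m : ℕ} (A : Fin m → Matrix (Fin n) (Fin n) ℝ) :
    Set (EuclideanSpace ℝ (Fin m)) :=
  Amap A '' spectraplex n

/-- The trace-normalized matrix exponential `X(y)`. -/
noncomputable def densityMat {n m : ℕ} (A : Fin m → Matrix (Fin n) (Fin n) ℝ)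
    (y : EuclideanSpace ℝ (Fin m)) : Matrix (Fin n) (Fin n) ℝ :=
  (Matrix.trace (NormedSpace.exp (matA A y)))⁻¹ • NormedSpace.exp (matA A y)

/-- Pairing two conjugated diagonal matrices under the trace weights the entries by the squared
entries of the transition matrix. -/
theorem trace_conj_diagonal_mul_conj_diagonal {ι : Type*} [Fintype ι] [DecidableEq ι]
    (V U : Matrix ι ι ℝ) (f g : ι → ℝ) :
    trace (V * diagonal f * Vᵀ * (U * diagonal g * Uᵀ)) =
      ∑ i, ∑ j, f i * g j * (Vᵀ * U) i j ^ 2 := by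
  have h : trace (V * diagonal f * Vᵀ * (U * diagonal g * Uᵀ)) =
      trace ((diagonal f * (Vᵀ * U)) * (diagonal g * (Vᵀ * U)ᵀ)) := by
    rw [transpose_mul, transpose_transpose]
    simp only [Matrix.mul_assoc]
    rw [trace_mul_comm V]
    simp only [Matrix.mul_assoc]
  rw [h, trace]
  refine Finset.sum_congr rfl fun i _ => ?_
  rw [diag_apply, mul_apply]
  refine Finset.sum_congr rfl fun j _ => ?_
  rw [diagonal_mul, diagonal_mul, transpose_apply]
  ring

/-- A real Hermitian matrix and its exponential are diagonalized by the same orthogonal matrix. -/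
theorem Matrix.IsHermitian.exists_orthogonal_conj_diagonal {ι : Type*} [Fintype ι] [DecidableEq ι]
    {M : Matrix ι ι ℝ} (hM : M.IsHermitian) :
    ∃ (U : Matrix ι ι ℝ) (d : ι → ℝ), U * Uᵀ = 1 ∧ Uᵀ * U = 1 ∧ M = U * diagonal d * Uᵀ ∧
      NormedSpace.exp M = U * diagonal (fun i => Real.exp (d i)) * Uᵀ := by
  obtain ⟨U, d, h₁, h₂, h⟩ : ∃ (U : Matrix ι ι ℝ) (d : ι → ℝ),
      U * Uᵀ = 1 ∧ Uᵀ * U = 1 ∧ M = U * diagonal d * Uᵀ := by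
    refine ⟨hM.eigenvectorUnitary, hM.eigenvalues, ?_, ?_, ?_⟩
    · exact Unitary.mul_star_self_of_mem hM.eigenvectorUnitary.2
    · exact Unitary.star_mul_self_of_mem hM.eigenvectorUnitary.2
    · exact hM.spectral_theorem
  refine ⟨U, d, h₁, h₂, h, ?_⟩
  have hinv : U⁻¹ = Uᵀ := inv_eq_right_inv h₁
  have hU : IsUnit U := ⟨⟨U, Uᵀ, h₁, h₂⟩, rfl⟩
  rw [h, ← hinv, exp_conj U _ hU, exp_diagonal]
  congr 3
  funext i
  rw [Pi.coe_exp, Real.exp_eq_exp_ℝ]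

/-- Strict gradient inequality for the trace exponential (Klein's inequality). -/
theorem trace_exp_add_trace_mul_exp_lt {ι : Type*} [Fintype ι] [DecidableEq ι]
    {X M : Matrix ι ι ℝ} (hX : X.IsHermitian) (hM : M.IsHermitian) (hne : X ≠ M) :
    trace (NormedSpace.exp M) + trace ((X - M) * NormedSpace.exp M) <
      trace (NormedSpace.exp X) := by
  obtain ⟨V, l, hV₁, hV₂, hXV, hXe⟩ := hX.exists_orthogonal_conj_diagonal
  obtain ⟨U, d, hU₁, hU₂, hMU, hMe⟩ := hM.exists_orthogonal_conj_diagonal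
  have hT := trace_conj_diagonal_mul_conj_diagonal V U
  have hMM : M * NormedSpace.exp M = U * diagonal (fun j => d j * Real.exp (d j)) * Uᵀ := by
    rw [hMe]
    nth_rw 1 [hMU]
    rw [← diagonal_mul_diagonal]
    simp only [Matrix.mul_assoc]
    rw [← Matrix.mul_assoc Uᵀ U, hU₂, Matrix.one_mul]
  have hV : V * diagonal (fun _ => (1 : ℝ)) * Vᵀ = 1 := by
    rw [diagonal_one, Matrix.mul_one, hV₁]
  have hU : U * diagonal (fun _ => (1 : ℝ)) * Uᵀ = 1 := by
    rw [diagonal_one, Matrix.mul_one, hU₁]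
  have e₁ := hT (fun i => Real.exp (l i)) (fun _ => 1)
  have e₂ := hT (fun _ => 1) (fun j => Real.exp (d j))
  have e₃ := hT l (fun j => Real.exp (d j))
  have e₄ := hT (fun _ => 1) (fun j => d j * Real.exp (d j))
  rw [hU, Matrix.mul_one, ← hXe] at e₁
  rw [hV, Matrix.one_mul, ← hMe] at e₂
  rw [← hXV, ← hMe] at e₃
  rw [hV, Matrix.one_mul, ← hMM] at e₄
  have hterm (s t : ℝ) : Real.exp t + (s - t) * Real.exp t ≤ Real.exp s := by
    have h := mul_le_mul_of_nonneg_right (Real.add_one_le_exp (s - t)) (Real.exp_pos t).le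
    rw [← Real.exp_add, sub_add_cancel] at h
    linarith
  have hterm' (s t : ℝ) (hst : s ≠ t) : Real.exp t + (s - t) * Real.exp t < Real.exp s := by
    have h := mul_lt_mul_of_pos_right (Real.add_one_lt_exp (sub_ne_zero.2 hst)) (Real.exp_pos t)
    rw [← Real.exp_add, sub_add_cancel] at h
    linarith
  obtain ⟨i₀, j₀, hw, hlt⟩ : ∃ i j, (Vᵀ * U) i j ≠ 0 ∧ l i ≠ d j := by
    by_contra! hcon
    have hcomm : diagonal l * (Vᵀ * U) = (Vᵀ * U) * diagonal d := by
      ext i j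
      rw [diagonal_mul, mul_diagonal]
      by_cases h0 : (Vᵀ * U) i j = 0
      · rw [h0]; ring
      · rw [hcon i j h0]; ring
    apply hne
    calc X = V * (diagonal l * (Vᵀ * U)) * Uᵀ := by
          rw [hXV]; simp only [Matrix.mul_assoc, hU₁, Matrix.mul_one]
      _ = (V * Vᵀ) * (U * diagonal d * Uᵀ) := by
          rw [hcomm]; simp only [Matrix.mul_assoc]
      _ = M := by rw [hV₁, Matrix.one_mul, ← hMU]
  rw [sub_mul, trace_sub, e₁, e₂, e₃, e₄]
  simp only [← Finset.sum_sub_distrib, ← Finset.sum_add_distrib]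
  have hle (i j : ι) :
      1 * Real.exp (d j) * (Vᵀ * U) i j ^ 2 + (l i * Real.exp (d j) * (Vᵀ * U) i j ^ 2 -
        1 * (d j * Real.exp (d j)) * (Vᵀ * U) i j ^ 2) ≤
      Real.exp (l i) * 1 * (Vᵀ * U) i j ^ 2 := by
    linarith [mul_le_mul_of_nonneg_right (hterm (l i) (d j)) (sq_nonneg ((Vᵀ * U) i j))]
  refine Finset.sum_lt_sum (fun i _ => Finset.sum_le_sum fun j _ => hle i j)
    ⟨i₀, Finset.mem_univ _, Finset.sum_lt_sum (fun j _ => hle i₀ j) ⟨j₀, Finset.mem_univ _, ?_⟩⟩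
  linarith [mul_lt_mul_of_pos_right (hterm' _ _ hlt) (sq_pos_of_ne_zero hw)]

/-- The trace exponential is strictly convex on Hermitian matrices. -/
theorem strictConvexOn_trace_exp {ι : Type*} [Fintype ι] [DecidableEq ι] :
    StrictConvexOn ℝ {M : Matrix ι ι ℝ | M.IsHermitian}
      fun M => trace (NormedSpace.exp M) := by
  have hconv {X Y : Matrix ι ι ℝ} (hX : X.IsHermitian) (hY : Y.IsHermitian) (s t : ℝ) :
      (s • X + t • Y).IsHermitian := by
    rw [IsHermitian, conjTranspose_add, conjTranspose_smul, conjTranspose_smul, hX.eq, hY.eq,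
      star_trivial, star_trivial]
  refine ⟨fun X hX Y hY s t _ _ _ => hconv hX hY s t, fun X hX Y hY hXY s t hs ht hst => ?_⟩
  obtain rfl : s = 1 - t := by linarith
  have hM := hconv hX hY (1 - t) t
  have hXM : X - ((1 - t) • X + t • Y) = t • (X - Y) := by module
  have hYM : Y - ((1 - t) • X + t • Y) = -(1 - t) • (X - Y) := by module
  have h₁ := trace_exp_add_trace_mul_exp_lt hX hM
    (sub_ne_zero.1 (hXM ▸ smul_ne_zero ht.ne' (sub_ne_zero.2 hXY)))
  have h₂ := trace_exp_add_trace_mul_exp_lt hY hM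
    (sub_ne_zero.1 (hYM ▸ smul_ne_zero (neg_ne_zero.2 hs.ne') (sub_ne_zero.2 hXY)))
  rw [hXM, Matrix.smul_mul, trace_smul, smul_eq_mul] at h₁
  rw [hYM, Matrix.smul_mul, trace_smul, smul_eq_mul] at h₂
  simp only [smul_eq_mul]
  linarith [mul_lt_mul_of_pos_left h₁ hs, mul_lt_mul_of_pos_left h₂ ht]

theorem Matrix.IsHermitian.trace_exp_pos {ι : Type*} [Fintype ι] [DecidableEq ι] [Nonempty ι]
    {M : Matrix ι ι ℝ} (hM : M.IsHermitian) : 0 < trace (NormedSpace.exp M) := by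
  obtain ⟨U, d, -, hU, -, hMe⟩ := hM.exists_orthogonal_conj_diagonal
  rw [hMe, trace_mul_comm, ← Matrix.mul_assoc, hU, Matrix.one_mul, trace_diagonal]
  exact Finset.sum_pos (fun i _ => Real.exp_pos _) Finset.univ_nonempty

theorem trace_exp_add_smul_one {ι : Type*} [Fintype ι] [DecidableEq ι]
    (M : Matrix ι ι ℝ) (c : ℝ) :
    trace (NormedSpace.exp (M + c • (1 : Matrix ι ι ℝ))) =
      Real.exp c * trace (NormedSpace.exp M) := by
  rw [exp_add_of_commute _ _ ((Commute.one_right M).smul_right c), smul_one_eq_diagonal,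
    exp_diagonal]
  have : NormedSpace.exp (fun _ : ι => c) = fun _ => Real.exp c := by
    funext i
    rw [Pi.coe_exp, Real.exp_eq_exp_ℝ]
  rw [this, ← smul_one_eq_diagonal, Matrix.mul_smul, Matrix.mul_one, trace_smul, smul_eq_mul]

/-- The log-trace-exponential is strictly convex transversally to the identity. -/
theorem log_trace_exp_convex_comb_lt {ι : Type*} [Fintype ι] [DecidableEq ι] [Nonempty ι]
    {X Y : Matrix ι ι ℝ} (hX : X.IsHermitian) (hY : Y.IsHermitian)
    (hXY : ∀ c : ℝ, X - Y ≠ c • (1 : Matrix ι ι ℝ)) {s t : ℝ} (hs : 0 < s) (ht : 0 < t)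
    (hst : s + t = 1) :
    Real.log (trace (NormedSpace.exp (s • X + t • Y))) <
      s * Real.log (trace (NormedSpace.exp X)) + t * Real.log (trace (NormedSpace.exp Y)) := by
  set x := Real.log (trace (NormedSpace.exp X)) with hx
  set y := Real.log (trace (NormedSpace.exp Y)) with hy
  have hshift {Z : Matrix ι ι ℝ} (hZ : Z.IsHermitian) (c : ℝ) :
      (Z + c • (1 : Matrix ι ι ℝ)).IsHermitian := by
    rw [IsHermitian, conjTranspose_add, conjTranspose_smul, conjTranspose_one, hZ.eq,
      star_trivial]
  have hne : X + (-x) • (1 : Matrix ι ι ℝ) ≠ Y + (-y) • (1 : Matrix ι ι ℝ) := by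
    intro h
    apply hXY (x - y)
    calc X - Y = (X + (-x) • (1 : Matrix ι ι ℝ)) - (Y + (-y) • (1 : Matrix ι ι ℝ))
          + (x - y) • (1 : Matrix ι ι ℝ) := by module
      _ = (x - y) • (1 : Matrix ι ι ℝ) := by rw [h, sub_self, zero_add]
  have h := strictConvexOn_trace_exp.2 (hshift hX (-x)) (hshift hY (-y)) hne hs ht hst
  have hcomb : s • (X + (-x) • (1 : Matrix ι ι ℝ)) + t • (Y + (-y) • (1 : Matrix ι ι ℝ)) =
      (s • X + t • Y) + (-(s * x + t * y)) • (1 : Matrix ι ι ℝ) := by module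
  have hpos : 0 < trace (NormedSpace.exp (s • X + t • Y)) := by
    have := strictConvexOn_trace_exp.1 hX hY hs.le ht.le hst
    exact IsHermitian.trace_exp_pos this
  simp only [hcomb, trace_exp_add_smul_one, smul_eq_mul] at h
  rw [Real.exp_neg x, Real.exp_neg y, hx, hy, Real.exp_log hX.trace_exp_pos,
    Real.exp_log hY.trace_exp_pos, ← hx, ← hy, inv_mul_cancel₀ hX.trace_exp_pos.ne',
    inv_mul_cancel₀ hY.trace_exp_pos.ne', mul_one, mul_one, hst, Real.exp_neg,
    inv_mul_lt_one₀ (Real.exp_pos _)] at h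
  exact (Real.log_lt_iff_lt_exp hpos).2 h

theorem matA_isHermitian {n m : ℕ} {A : Fin m → Matrix (Fin n) (Fin n) ℝ}
    (hA : ∀ i, (A i)ᵀ = A i) (y : EuclideanSpace ℝ (Fin m)) : (matA A y).IsHermitian := by
  rw [IsHermitian, conjTranspose_eq_transpose_of_trivial, matA, transpose_sum]
  simp only [transpose_smul, hA]

theorem matA_add {n m : ℕ} (A : Fin m → Matrix (Fin n) (Fin n) ℝ)
    (x y : EuclideanSpace ℝ (Fin m)) : matA A (x + y) = matA A x + matA A y := by
  simp only [matA, PiLp.add_apply, add_smul, Finset.sum_add_distrib]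

theorem matA_smul {n m : ℕ} (A : Fin m → Matrix (Fin n) (Fin n) ℝ)
    (s : ℝ) (x : EuclideanSpace ℝ (Fin m)) : matA A (s • x) = s • matA A x := by
  simp only [matA, PiLp.smul_apply, smul_eq_mul, mul_smul, Finset.smul_sum]

theorem matA_sub_ne_smul_one {n m : ℕ} {A : Fin m → Matrix (Fin n) (Fin n) ℝ}
    (hind : LinearIndependent ℝ
      (Fin.cons (1 : Matrix (Fin n) (Fin n) ℝ) A : Fin (m + 1) → Matrix (Fin n) (Fin n) ℝ))
    {x y : EuclideanSpace ℝ (Fin m)} (hxy : x ≠ y) (c : ℝ) :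
    matA A x - matA A y ≠ c • (1 : Matrix (Fin n) (Fin n) ℝ) := by
  intro h
  have h0 := Fintype.linearIndependent_iff.1 hind (Fin.cons (-c) fun i => x i - y i) (by
    simp only [Fin.sum_univ_succ, Fin.cons_zero, Fin.cons_succ, sub_smul,
      Finset.sum_sub_distrib]
    change (-c) • (1 : Matrix (Fin n) (Fin n) ℝ) + (matA A x - matA A y) = 0
    rw [h]
    module)
  apply hxy
  ext i
  simpa [sub_eq_zero] using h0 i.succ

/-- linear independence of I, A_1, ..., A_m implies strict convexity. -/
theorem stmt2 (n m : ℕ) (hn : 1 ≤ n)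
    (A : Fin m → Matrix (Fin n) (Fin n) ℝ) (hA : ∀ i, (A i)ᵀ = A i)
    (hind : LinearIndependent ℝ
      (Fin.cons (1 : Matrix (Fin n) (Fin n) ℝ) A : Fin (m + 1) → Matrix (Fin n) (Fin n) ℝ))
    (b : EuclideanSpace ℝ (Fin m)) :
    StrictConvexOn ℝ Set.univ (logPart A b) := by
  have : Nonempty (Fin n) := ⟨⟨0, hn⟩⟩
  refine ⟨convex_univ, fun x _ y _ hxy s t hs ht hst => ?_⟩
  have h := log_trace_exp_convex_comb_lt (matA_isHermitian hA x) (matA_isHermitian hA y)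
    (matA_sub_ne_smul_one hind hxy) hs ht hst
  simp only [logPart, matA_add, matA_smul, inner_add_right, inner_smul_right, smul_eq_mul]
  linarith
end

section
/- Assume the identity matrix I_n together with A_1, …, A_m are linearly independent, b lies in the interior of the moment body ℳ, and let y* be a global minimizer of f. Set X* := exp(A(y*)) / tr(exp(A(y*))). Then 𝒜(X*) = b, and X* maximizes the von Neumann entropy among feasible states: for every symmetric positive semidefinite matrix X with tr(X) = 1 and 𝒜(X) = b, one has ∑_{k} negMulLog(λ_k(X)) ≤ ∑_{k} negMulLog(λ_k(X*)), where λ_k(·) are the eigenvalues of the Hermitian matrix and negMulLog(t) = −t·log t. -/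
open Matrix Filter
open scoped RealInnerProductSpace

open Polynomial in
/-- Summing a function over the eigenvalues of a real symmetric matrix can be done over the
diagonal of any orthogonal diagonalization. -/
theorem sum_eigenvalues_eq_of_eq_conj_diagonal {ι : Type*} [Fintype ι] [DecidableEq ι]
    {X U : Matrix ι ι ℝ} (hX : X.IsHermitian) (hU : Uᴴ * U = 1) {x : ι → ℝ}
    (h : X = U * diagonal x * Uᴴ) (g : ℝ → ℝ) :
    ∑ k, g (hX.eigenvalues k) = ∑ k, g (x k) := by
  have hroots : X.charpoly.roots = Multiset.map x Finset.univ.val := by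
    rw [h, charpoly_mul_comm, ← mul_assoc, hU, one_mul, charpoly_diagonal, Polynomial.roots_prod]
    · simp
    · simp [Finset.prod_ne_zero_iff, Polynomial.X_sub_C_ne_zero]
  have key := congrArg (fun s => (s.map g).sum)
    (hX.roots_charpoly_eq_eigenvalues.symm.trans hroots)
  simpa [Multiset.map_map, Function.comp_def] using key

/-- Simultaneous diagonalization of a real symmetric matrix and its exponential. -/
theorem exists_diagonalization_exp {ι : Type*} [Fintype ι] [DecidableEq ι]
    {H : Matrix ι ι ℝ} (hH : H.IsHermitian) :
    ∃ (U : Matrix ι ι ℝ) (d : ι → ℝ), Uᴴ * U = 1 ∧ U * Uᴴ = 1 ∧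
      H = U * diagonal d * Uᴴ ∧
      NormedSpace.exp H = U * diagonal (fun i => Real.exp (d i)) * Uᴴ := by
  have hl : (hH.eigenvectorUnitary : Matrix ι ι ℝ)ᴴ * hH.eigenvectorUnitary = 1 :=
    Unitary.coe_star_mul_self hH.eigenvectorUnitary
  have hr : (hH.eigenvectorUnitary : Matrix ι ι ℝ) * (hH.eigenvectorUnitary : Matrix ι ι ℝ)ᴴ = 1 :=
    Unitary.coe_mul_star_self hH.eigenvectorUnitary
  have hspec : H = hH.eigenvectorUnitary * diagonal hH.eigenvalues *
      (hH.eigenvectorUnitary : Matrix ι ι ℝ)ᴴ := by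
    simpa [Unitary.conjStarAlgAut_apply, star_eq_conjTranspose] using hH.spectral_theorem
  refine ⟨hH.eigenvectorUnitary, hH.eigenvalues, hl, hr, hspec, ?_⟩
  have hinv : (hH.eigenvectorUnitary : Matrix ι ι ℝ)ᴴ = (hH.eigenvectorUnitary : Matrix ι ι ℝ)⁻¹ :=
    (inv_eq_left_inv hl).symm
  conv_lhs => rw [hspec, hinv, exp_conj _ _ (IsUnit.of_mul_eq_one _ hr), exp_diagonal, ← hinv]
  congr 3
  ext i
  rw [Pi.coe_exp, Real.exp_eq_exp_ℝ]

theorem trace_conj_of_conjTranspose_mul_self {ι : Type*} [Fintype ι] [DecidableEq ι]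
    {U : Matrix ι ι ℝ} (hU : Uᴴ * U = 1) (D : Matrix ι ι ℝ) :
    (U * D * Uᴴ).trace = D.trace := by
  rw [trace_mul_comm, ← mul_assoc, hU, one_mul]

theorem sum_sq_row_of_mul_conjTranspose {ι : Type*} [Fintype ι] [DecidableEq ι]
    {W : Matrix ι ι ℝ} (hW : W * Wᴴ = 1) (i : ι) : ∑ j, W i j ^ 2 = 1 := by
  have := congrFun (congrFun hW i) i
  simpa [mul_apply, ← sq] using this

theorem trace_diagonal_mul_conj_diagonal {ι : Type*} [Fintype ι] [DecidableEq ι]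
    (W : Matrix ι ι ℝ) (d x : ι → ℝ) :
    (diagonal d * (W * diagonal x * Wᴴ)).trace = ∑ i, ∑ j, d i * x j * W i j ^ 2 := by
  simp only [trace, diag_apply, diagonal_mul, mul_apply (M := W * diagonal x), mul_diagonal,
    conjTranspose_apply, star_trivial, Finset.mul_sum]
  exact Finset.sum_congr rfl fun i _ => Finset.sum_congr rfl fun j _ => by ring

/-- The scalar Young-type inequality behind the Gibbs variational principle. -/
theorem negMulLog_add_mul_le {x h L : ℝ} (hx : 0 ≤ x) :
    Real.negMulLog x + h * x ≤ x * L + Real.exp (h - L) - x := by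
  rcases hx.eq_or_lt with rfl | hx
  · simpa using (Real.exp_pos (h - L)).le
  · have h1 := Real.add_one_le_exp (h - L - Real.log x)
    rw [Real.exp_sub, Real.exp_log hx, le_div_iff₀ hx] at h1
    rw [Real.negMulLog]
    nlinarith

/-- **Gibbs variational principle**, upper bound. -/
theorem entropy_add_trace_le_log_trace_exp {ι : Type*} [Fintype ι] [DecidableEq ι] [Nonempty ι]
    {H X : Matrix ι ι ℝ} (hH : H.IsHermitian) (hX : X.PosSemidef) (htr : X.trace = 1) :
    ∑ k, Real.negMulLog (hX.1.eigenvalues k) + (H * X).trace ≤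
      Real.log (NormedSpace.exp H).trace := by
  obtain ⟨U, d, hU, hU', hHd, hexp⟩ := exists_diagonalization_exp hH
  obtain ⟨V, x, hV, hV', hXd, -⟩ := exists_diagonalization_exp hX.1
  have hZ : (NormedSpace.exp H).trace = ∑ i, Real.exp (d i) := by
    rw [hexp, trace_conj_of_conjTranspose_mul_self hU, trace_diagonal]
  have hsum : ∑ j, x j = 1 := by
    rw [← htr, hXd, trace_conj_of_conjTranspose_mul_self hV, trace_diagonal]
  have hx : ∀ j, 0 ≤ x j := by
    have hD : (diagonal x).PosSemidef := by
      have := hX.conjTranspose_mul_mul_same V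
      rwa [hXd, show Vᴴ * (V * diagonal x * Vᴴ) * V = (Vᴴ * V) * diagonal x * (Vᴴ * V) by
        simp only [mul_assoc], hV, one_mul, mul_one] at this
    exact posSemidef_diagonal_iff.mp hD
  set W := Uᴴ * V with hWdef
  have hWr : W * Wᴴ = 1 := by
    rw [hWdef, conjTranspose_mul, conjTranspose_conjTranspose, mul_assoc, ← mul_assoc V, hV',
      one_mul, hU]
  have hWc : Wᴴ * Wᴴᴴ = 1 := by
    rw [conjTranspose_conjTranspose, hWdef, conjTranspose_mul, conjTranspose_conjTranspose,
      mul_assoc, ← mul_assoc U, hU', one_mul, hV]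
  have hrow := sum_sq_row_of_mul_conjTranspose hWr
  have hcol : ∀ j, ∑ i, W i j ^ 2 = 1 := by
    simpa using sum_sq_row_of_mul_conjTranspose hWc
  have htrace : (H * X).trace = ∑ i, ∑ j, d i * x j * W i j ^ 2 := by
    rw [← trace_diagonal_mul_conj_diagonal, hHd, hXd, hWdef, conjTranspose_mul,
      conjTranspose_conjTranspose, mul_assoc, mul_assoc, trace_mul_comm]
    simp only [mul_assoc]
  rw [sum_eigenvalues_eq_of_eq_conj_diagonal hX.1 hV hXd, htrace, hZ]
  set Z := ∑ i, Real.exp (d i)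
  have hZpos : 0 < Z := Finset.sum_pos (fun i _ => Real.exp_pos _) Finset.univ_nonempty
  have hent : ∑ j, Real.negMulLog (x j) = ∑ i, ∑ j, Real.negMulLog (x j) * W i j ^ 2 := by
    rw [Finset.sum_comm]
    simp only [← Finset.mul_sum, hcol, mul_one]
  calc _ = ∑ i, ∑ j, (Real.negMulLog (x j) + d i * x j) * W i j ^ 2 := by
        rw [hent]; simp only [add_mul, Finset.sum_add_distrib]
    _ ≤ ∑ i, ∑ j, (x j * Real.log Z + Real.exp (d i - Real.log Z) - x j) * W i j ^ 2 :=
        Finset.sum_le_sum fun i _ => Finset.sum_le_sum fun j _ =>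
          mul_le_mul_of_nonneg_right (negMulLog_add_mul_le (hx j)) (sq_nonneg _)
    _ = ∑ j, (x j * Real.log Z - x j) + ∑ i, Real.exp (d i - Real.log Z) := by
        have h1 : ∑ j, (x j * Real.log Z - x j) =
            ∑ i, ∑ j, (x j * Real.log Z - x j) * W i j ^ 2 := by
          rw [Finset.sum_comm]
          simp only [← Finset.mul_sum, hcol, mul_one]
        have h2 : ∑ i, Real.exp (d i - Real.log Z) =
            ∑ i, ∑ j, Real.exp (d i - Real.log Z) * W i j ^ 2 := by
          simp only [← Finset.mul_sum, hrow, mul_one]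
        rw [h1, h2]
        simp only [← Finset.sum_add_distrib]
        exact Finset.sum_congr rfl fun i _ => Finset.sum_congr rfl fun j _ => by ring
    _ = Real.log Z := by
        simp only [Real.exp_sub, Real.exp_log hZpos, ← Finset.sum_div, Finset.sum_sub_distrib,
          ← Finset.sum_mul, hsum]
        rw [div_self hZpos.ne']
        ring

/-- The Gibbs state `exp H / tr exp H` is a density matrix. -/
theorem gibbs_posSemidef_and_trace {ι : Type*} [Fintype ι] [DecidableEq ι] [Nonempty ι]
    {H : Matrix ι ι ℝ} (hH : H.IsHermitian) :
    0 < (NormedSpace.exp H).trace ∧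
    ((NormedSpace.exp H).trace⁻¹ • NormedSpace.exp H).PosSemidef ∧
      ((NormedSpace.exp H).trace⁻¹ • NormedSpace.exp H).trace = 1 := by
  obtain ⟨U, d, hU, hU', hHd, hexp⟩ := exists_diagonalization_exp hH
  have hZ : 0 < (NormedSpace.exp H).trace := by
    rw [hexp, trace_conj_of_conjTranspose_mul_self hU, trace_diagonal]
    exact Finset.sum_pos (fun i _ => Real.exp_pos _) Finset.univ_nonempty
  refine ⟨hZ, PosSemidef.smul ?_ (inv_pos.mpr hZ).le, ?_⟩
  · rw [hexp]
    exact (posSemidef_diagonal_iff.mpr fun i => (Real.exp_pos _).le).mul_mul_conjTranspose_same U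
  · rw [trace_smul, smul_eq_mul, inv_mul_cancel₀ hZ.ne']

/-- **Gibbs variational principle**, equality at the Gibbs state. -/
theorem entropy_gibbs_add_trace {ι : Type*} [Fintype ι] [DecidableEq ι] [Nonempty ι]
    {H : Matrix ι ι ℝ} (hH : H.IsHermitian)
    (hX : ((NormedSpace.exp H).trace⁻¹ • NormedSpace.exp H).IsHermitian) :
    ∑ k, Real.negMulLog (hX.eigenvalues k) +
        (H * ((NormedSpace.exp H).trace⁻¹ • NormedSpace.exp H)).trace =
      Real.log (NormedSpace.exp H).trace := by
  have hZ := (gibbs_posSemidef_and_trace hH).1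
  obtain ⟨U, d, hU, hU', hHd, hexp⟩ := exists_diagonalization_exp hH
  have hZsum : (NormedSpace.exp H).trace = ∑ i, Real.exp (d i) := by
    rw [hexp, trace_conj_of_conjTranspose_mul_self hU, trace_diagonal]
  set Z := (NormedSpace.exp H).trace
  have hXd : Z⁻¹ • NormedSpace.exp H = U * diagonal (fun i => Z⁻¹ * Real.exp (d i)) * Uᴴ := by
    rw [hexp, ← Matrix.smul_mul, ← Matrix.mul_smul, ← diagonal_smul]
    rfl
  have htr : (H * (Z⁻¹ • NormedSpace.exp H)).trace = ∑ i, d i * (Z⁻¹ * Real.exp (d i)) := by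
    rw [hXd]
    nth_rw 1 [hHd]
    rw [show U * diagonal d * Uᴴ * (U * diagonal (fun i => Z⁻¹ * Real.exp (d i)) * Uᴴ) =
        U * (diagonal d * (Uᴴ * U) * diagonal (fun i => Z⁻¹ * Real.exp (d i))) * Uᴴ by
      simp only [mul_assoc], hU, mul_one, trace_conj_of_conjTranspose_mul_self hU,
      diagonal_mul_diagonal, trace_diagonal]
  rw [sum_eigenvalues_eq_of_eq_conj_diagonal hX hU hXd, htr, ← Finset.sum_add_distrib]
  calc _ = ∑ i, Real.exp (d i) * (Z⁻¹ * Real.log Z) := by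
        refine Finset.sum_congr rfl fun i _ => ?_
        rw [Real.negMulLog, Real.log_mul (inv_ne_zero hZ.ne') (Real.exp_ne_zero _), Real.log_inv,
          Real.log_exp]
        ring
    _ = Real.log Z := by
        rw [← Finset.sum_mul, ← hZsum, mul_inv_cancel_left₀ hZ.ne']

theorem trace_matA_mul {n m : ℕ} (A : Fin m → Matrix (Fin n) (Fin n) ℝ)
    (y : EuclideanSpace ℝ (Fin m)) (X : Matrix (Fin n) (Fin n) ℝ) :
    (matA A y * X).trace = ⟪Amap A X, y⟫ := by
  simp [matA, Amap, Finset.sum_mul, trace_sum, PiLp.inner_apply]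

/-- Subgradient inequality for the log-partition function. -/
theorem logPart_add_inner_le {n m : ℕ} (hn : 1 ≤ n) {A : Fin m → Matrix (Fin n) (Fin n) ℝ}
    (hA : ∀ i, (A i)ᵀ = A i) (b y z : EuclideanSpace ℝ (Fin m)) :
    logPart A b y + ⟪Amap A (densityMat A y) - b, z - y⟫ ≤ logPart A b z := by
  have : Nonempty (Fin n) := ⟨⟨0, hn⟩⟩
  obtain ⟨-, hpsd, htr⟩ := gibbs_posSemidef_and_trace (matA_isHermitian hA y)
  have h1 := entropy_add_trace_le_log_trace_exp (matA_isHermitian hA z) hpsd htr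
  have h2 := entropy_gibbs_add_trace (matA_isHermitian hA y) hpsd.1
  rw [trace_matA_mul] at h1 h2
  simp only [logPart, densityMat, inner_sub_left, inner_sub_right]
  linarith

theorem continuous_matrix_exp {ι : Type*} [Fintype ι] [DecidableEq ι] :
    Continuous (NormedSpace.exp : Matrix ι ι ℝ → Matrix ι ι ℝ) := by
  let _ : NormedRing (Matrix ι ι ℝ) := Matrix.linftyOpNormedRing
  let _ : NormedAlgebra ℝ (Matrix ι ι ℝ) := Matrix.linftyOpNormedAlgebra
  let _ : NormedAlgebra ℚ (Matrix ι ι ℝ) := NormedAlgebra.restrictScalars ℚ ℝ _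
  exact NormedSpace.exp_continuous

theorem continuous_Amap_densityMat {n m : ℕ} (hn : 1 ≤ n)
    {A : Fin m → Matrix (Fin n) (Fin n) ℝ} (hA : ∀ i, (A i)ᵀ = A i) :
    Continuous fun y => Amap A (densityMat A y) := by
  have : Nonempty (Fin n) := ⟨⟨0, hn⟩⟩
  have hmat : Continuous (matA A) :=
    continuous_finsetSum _ fun i _ => (PiLp.continuous_apply 2 _ i).smul continuous_const
  have hexp := continuous_matrix_exp.comp hmat
  have hdens : Continuous (densityMat A) :=
    (hexp.matrix_trace.inv₀ fun y =>
      (gibbs_posSemidef_and_trace (matA_isHermitian hA y)).1.ne').smul hexp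
  exact (PiLp.continuous_toLp 2 _).comp <|
    continuous_pi fun i => (continuous_const.matrix_mul hdens).matrix_trace

/-- First-order optimality for the log-partition function. -/
theorem Amap_densityMat_eq_of_forall_logPart_le {n m : ℕ} (hn : 1 ≤ n)
    {A : Fin m → Matrix (Fin n) (Fin n) ℝ} (hA : ∀ i, (A i)ᵀ = A i)
    {b y : EuclideanSpace ℝ (Fin m)} (hmin : ∀ z, logPart A b y ≤ logPart A b z) :
    Amap A (densityMat A y) = b := by
  set g : EuclideanSpace ℝ (Fin m) → EuclideanSpace ℝ (Fin m) :=
    fun z => Amap A (densityMat A z) - b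
  have hg : Continuous g := (continuous_Amap_densityMat hn hA).sub continuous_const
  set v := -g y with hv
  have hpos : ∀ t : ℝ, 0 < t → 0 ≤ ⟪g (y + t • v), v⟫ := by
    intro t ht
    have h := (logPart_add_inner_le hn hA b (y + t • v) y).trans (hmin (y + t • v))
    rw [sub_add_cancel_left, inner_neg_right, inner_smul_right] at h
    exact nonneg_of_mul_nonneg_right (by linarith) ht
  have hcont : Continuous fun t : ℝ => ⟪g (y + t • v), v⟫ := by fun_prop
  have hlim : Tendsto (fun t : ℝ => ⟪g (y + t • v), v⟫) (nhdsWithin 0 (Set.Ioi 0))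
      (nhds ⟪g y, v⟫) := by
    simpa using (hcont.tendsto 0).mono_left nhdsWithin_le_nhds
  have h0 : 0 ≤ ⟪g y, v⟫ :=
    ge_of_tendsto hlim (eventually_nhdsWithin_of_forall fun t ht => hpos t ht)
  rw [hv, inner_neg_right, real_inner_self_eq_norm_sq] at h0
  have hzero : ‖g y‖ = 0 := by nlinarith [norm_nonneg (g y)]
  exact sub_eq_zero.mp (norm_eq_zero.mp hzero)

/-- the normalized exponential at the minimizer is feasible and
maximizes the von Neumann entropy among feasible states. -/
theorem stmt5 (n m : ℕ) (hn : 1 ≤ n)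
    (A : Fin m → Matrix (Fin n) (Fin n) ℝ) (hA : ∀ i, (A i)ᵀ = A i)
    (hind : LinearIndependent ℝ
      (Fin.cons (1 : Matrix (Fin n) (Fin n) ℝ) A : Fin (m + 1) → Matrix (Fin n) (Fin n) ℝ))
    (b : EuclideanSpace ℝ (Fin m)) (hb : b ∈ interior (momentBody A))
    (ystar : EuclideanSpace ℝ (Fin m))
    (hmin : ∀ y, logPart A b ystar ≤ logPart A b y)
    (hXstar : (densityMat A ystar).IsHermitian) :
    Amap A (densityMat A ystar) = b ∧
    ∀ (X : Matrix (Fin n) (Fin n) ℝ) (hX : X.PosSemidef), X.IsSymm → X.trace = 1 →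
      Amap A X = b →
      ∑ k, Real.negMulLog (hX.1.eigenvalues k) ≤
        ∑ k, Real.negMulLog (hXstar.eigenvalues k) := by
  have : Nonempty (Fin n) := ⟨⟨0, hn⟩⟩
  have hfeas := Amap_densityMat_eq_of_forall_logPart_le hn hA hmin
  refine ⟨hfeas, fun X hX _ htr hXb => ?_⟩
  have h1 := entropy_add_trace_le_log_trace_exp (matA_isHermitian hA ystar) hX htr
  have h2 := entropy_gibbs_add_trace (matA_isHermitian hA ystar) hXstar
  rw [trace_matA_mul, hXb] at h1
  change _ + (matA A ystar * densityMat A ystar).trace = _ at h2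
  rw [trace_matA_mul, hfeas] at h2
  change _ ≤ ∑ k, Real.negMulLog (hXstar.eigenvalues k)
  exact le_of_add_le_add_right (h1.trans h2.ge)
end

section
/- Assume the matrices A_1, …, A_m are traceless and orthonormal: tr(A_i) = 0 and tr(A_i A_j) = δ_{ij}. Then for every symmetric positive semidefinite matrix X with tr(X) = 1, the Euclidean norm of 𝒜(X) satisfies ‖𝒜(X)‖₂ ≤ √((n−1)/n) < 1. -/
open Matrix Filter
open scoped RealInnerProductSpace

open scoped MatrixOrder Matrix.Norms.L2Operator in
/-- The Frobenius bound `tr(X²) ≤ (tr X)²` for a positive semidefinite matrix. -/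
theorem Matrix.PosSemidef.trace_mul_self_le_sq {ι : Type*} [Fintype ι] [DecidableEq ι]
    {X : Matrix ι ι ℝ} (hX : X.PosSemidef) : (X * X).trace ≤ X.trace ^ 2 := by
  obtain ⟨B, rfl⟩ : ∃ B : Matrix ι ι ℝ, X = Bᴴ * B :=
    CStarAlgebra.nonneg_iff_eq_star_mul_self.mp hX.nonneg
  simp only [Matrix.trace, Matrix.diag_apply, Matrix.mul_apply, Matrix.conjTranspose_apply,
    star_trivial]
  rw [sq, Finset.sum_mul_sum]
  refine Finset.sum_le_sum fun i _ => Finset.sum_le_sum fun j _ => ?_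
  have h := Finset.sum_mul_sq_le_sq_mul_sq Finset.univ (fun k => B k i) (fun k => B k j)
  simp only [sq] at h
  simpa only [mul_comm (B _ j) (B _ i)] using h

/-- A real symmetric matrix satisfies `0 ≤ tr(Y²)`. -/
theorem Matrix.IsSymm.trace_mul_self_nonneg {ι : Type*} [Fintype ι]
    {Y : Matrix ι ι ℝ} (hY : Y.IsSymm) : 0 ≤ (Y * Y).trace := by
  simp only [Matrix.trace, Matrix.diag_apply, Matrix.mul_apply]
  refine Finset.sum_nonneg fun i _ => Finset.sum_nonneg fun j _ => ?_
  rw [hY.apply i j]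
  exact mul_self_nonneg _

/-- Bessel's inequality for the trace pairing, with a traceless orthonormal family completed by
the normalized identity. -/
theorem Matrix.IsSymm.sum_sq_trace_mul_le {ι κ : Type*} [Fintype ι] [DecidableEq ι] [Nonempty ι]
    [Fintype κ] [DecidableEq κ] {A : κ → Matrix ι ι ℝ} (hA : ∀ i, (A i).IsSymm)
    (htr : ∀ i, (A i).trace = 0)
    (horth : ∀ i j, (A i * A j).trace = (1 : Matrix κ κ ℝ) i j)
    {X : Matrix ι ι ℝ} (hX : X.IsSymm) :
    ∑ i, (A i * X).trace ^ 2 ≤ (X * X).trace - X.trace ^ 2 / Fintype.card ι := by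
  set c : κ → ℝ := fun i => (A i * X).trace with hc
  set Z := ∑ i, c i • A i with hZ
  have hZs : Z.IsSymm := by
    rw [Matrix.IsSymm, hZ, Matrix.transpose_sum]
    exact Finset.sum_congr rfl fun i _ => by rw [Matrix.transpose_smul, (hA i).eq]
  have hZM (M : Matrix ι ι ℝ) : (Z * M).trace = ∑ i, c i * (A i * M).trace := by
    simp [hZ, Finset.sum_mul, Matrix.trace_sum]
  have hZ0 : Z.trace = 0 := by simp [hZ, Matrix.trace_sum, htr]
  have hZX : (Z * X).trace = ∑ i, c i ^ 2 := by
    rw [hZM]; exact Finset.sum_congr rfl fun i _ => (sq _).symm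
  have hAZ (i : κ) : (A i * Z).trace = c i := by
    simp [Matrix.trace_mul_comm (A i), hZM, horth, Matrix.one_apply]
  have hZZ : (Z * Z).trace = ∑ i, c i ^ 2 := by
    rw [hZM]; exact Finset.sum_congr rfl fun i _ => by rw [hAZ, sq]
  set t : ℝ := X.trace / Fintype.card ι with ht
  have hY : (X - t • (1 : Matrix ι ι ℝ) - Z).IsSymm :=
    (hX.sub (Matrix.isSymm_one.smul t)).sub hZs
  have hpos := hY.trace_mul_self_nonneg
  have hn : (Fintype.card ι : ℝ) ≠ 0 := by exact_mod_cast Fintype.card_ne_zero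
  simp only [sub_mul, mul_sub, Matrix.trace_sub, smul_mul_assoc, mul_smul_comm, one_mul, mul_one,
    Matrix.trace_smul, Matrix.trace_one, smul_eq_mul, hZ0, hZZ, Matrix.trace_mul_comm X Z,
    hZX] at hpos
  have htn : t * Fintype.card ι = X.trace := by rw [ht]; field_simp
  have htt : X.trace ^ 2 / Fintype.card ι = t * X.trace := by rw [ht]; ring
  rw [htn] at hpos
  rw [htt]
  linarith

/-- radius bound for a traceless orthonormal moment body. -/
theorem stmt10 (n m : ℕ) (hn : 1 ≤ n)
    (A : Fin m → Matrix (Fin n) (Fin n) ℝ) (hA : ∀ i, (A i)ᵀ = A i)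
    (htr : ∀ i, (A i).trace = 0)
    (horth : ∀ i j, Matrix.trace (A i * A j) = (1 : Matrix (Fin m) (Fin m) ℝ) i j) :
    (∀ X ∈ spectraplex n, ‖Amap A X‖ ≤ Real.sqrt (((n : ℝ) - 1) / n)) ∧
    Real.sqrt (((n : ℝ) - 1) / n) < 1 := by
  have hn0 : (0 : ℝ) < n := by exact_mod_cast hn
  constructor
  · rintro X ⟨hXs, hXp, hX1⟩
    have : Nonempty (Fin n) := ⟨⟨0, hn⟩⟩
    have hB := hXs.sum_sq_trace_mul_le hA htr horth
    have hF := hXp.trace_mul_self_le_sq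
    rw [hX1, Fintype.card_fin] at hB
    rw [hX1] at hF
    rw [EuclideanSpace.norm_eq]
    apply Real.sqrt_le_sqrt
    simp only [Amap, Real.norm_eq_abs, sq_abs]
    rw [sub_div, div_self hn0.ne']
    linarith
  · rw [Real.sqrt_lt' one_pos, one_pow, div_lt_one hn0]
    linarith
end

section
/- Let A be a symmetric n×n real matrix with tr(A) = 0 and Frobenius norm 1 (i.e., tr(A·A) = 1). Then its spectral gap satisfies √(n / (⌊n/2⌋ · ⌈n/2⌉)) ≤ λ_max(A) − λ_min(A) ≤ √2, where λ_max(A) and λ_min(A) are the largest and smallest eigenvalues of A. -/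
open Matrix Filter
open scoped RealInnerProductSpace

theorem Matrix.IsHermitian.trace_mul_self_eq_sum_sq_eigenvalues {ι : Type*} [Fintype ι]
    [DecidableEq ι] {A : Matrix ι ι ℝ} (hA : A.IsHermitian) :
    (A * A).trace = ∑ i, hA.eigenvalues i ^ 2 := by
  conv_lhs => rw [hA.spectral_theorem, ← map_mul, Unitary.conjStarAlgAut_apply, trace_mul_cycle,
    Unitary.coe_star_mul_self, one_mul, diagonal_mul_diagonal, trace_diagonal]
  simp [sq]

theorem sum_sum_sub_sq {ι : Type*} [Fintype ι] (x : ι → ℝ) :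
    ∑ i, ∑ j, (x i - x j) ^ 2 = 2 * (Fintype.card ι * ∑ i, x i ^ 2 - (∑ i, x i) ^ 2) := by
  simp only [sub_sq, Finset.sum_add_distrib, Finset.sum_sub_distrib, Finset.sum_const,
    Finset.card_univ, nsmul_eq_mul, ← Finset.mul_sum, ← Finset.sum_mul]
  ring

theorem convexOn_sum_sum_sub_sq {ι : Type*} [Fintype ι] :
    ConvexOn ℝ Set.univ fun x : ι → ℝ => ∑ i, ∑ j, (x i - x j) ^ 2 := by
  refine ⟨convex_univ, fun x _ y _ s t hs ht hst => ?_⟩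
  simp only [smul_eq_mul, Finset.mul_sum, ← Finset.sum_add_distrib]
  refine Finset.sum_le_sum fun i _ => Finset.sum_le_sum fun j _ => ?_
  have h := (even_two.convexOn_pow (𝕜 := ℝ)).2 (Set.mem_univ (x i - x j))
    (Set.mem_univ (y i - y j)) hs ht hst
  simp only [smul_eq_mul] at h
  convert h using 2
  simp only [Pi.add_apply, Pi.smul_apply, smul_eq_mul]
  ring

theorem Nat.mul_le_half_mul_half (k l : ℕ) :
    k * l ≤ ((k + l) / 2) * ((k + l + 1) / 2) := by
  obtain ⟨p, hp⟩ : ∃ p, p = (k + l) / 2 := ⟨_, rfl⟩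
  obtain ⟨q, hq⟩ : ∃ q, q = (k + l + 1) / 2 := ⟨_, rfl⟩
  rw [← hp, ← hq]
  have hpq : k + l = p + q := by omega
  rcases le_or_gt k p with h | h
  · obtain ⟨d, rfl⟩ := Nat.exists_eq_add_of_le h
    obtain rfl : l = d + q := by omega
    have : k ≤ q := by omega
    nlinarith [Nat.zero_le d]
  · have h' : q ≤ k := by omega
    obtain ⟨d, rfl⟩ := Nat.exists_eq_add_of_le h'
    obtain rfl : p = l + d := by omega
    have : l ≤ q := by omega
    nlinarith [Nat.zero_le d]

/-- Sharp form of Popoviciu's inequality, taking the parity of the number of points into account. -/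
theorem card_mul_sum_sq_sub_sq_sum_le {ι : Type*} [Fintype ι] {a b : ℝ} {x : ι → ℝ}
    (hx : ∀ i, x i ∈ Set.Icc a b) :
    Fintype.card ι * ∑ i, x i ^ 2 - (∑ i, x i) ^ 2 ≤
      ((Fintype.card ι / 2 * ((Fintype.card ι + 1) / 2) : ℕ) : ℝ) * (b - a) ^ 2 := by
  classical
  have hmem : x ∈ convexHull ℝ (Set.univ.pi fun _ : ι => ({a, b} : Set ℝ)) := by
    rw [convexHull_pi]
    intro i _
    rw [convexHull_pair, segment_eq_Icc ((hx i).1.trans (hx i).2)]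
    exact hx i
  obtain ⟨y, hy, hxy⟩ :=
    convexOn_sum_sum_sub_sq.exists_ge_of_mem_convexHull (Set.subset_univ _) hmem
  rw [sum_sum_sub_sq, sum_sum_sub_sq] at hxy
  let T : Finset ι := Finset.univ.filter fun i => y i = a
  have hsum (f : ℝ → ℝ) : ∑ i, f (y i) = T.card * f a + Tᶜ.card * f b := by
    rw [← Finset.sum_add_sum_compl T, ← nsmul_eq_mul, ← nsmul_eq_mul]
    refine congrArg₂ _ (Finset.sum_eq_card_nsmul fun i hi => ?_)
      (Finset.sum_eq_card_nsmul fun i hi => ?_)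
    · rw [(Finset.mem_filter.1 hi).2]
    · rw [(hy i trivial).resolve_left fun h => Finset.mem_compl.1 hi (by simp [T, h])]
  have hle := Nat.mul_le_half_mul_half T.card Tᶜ.card
  have hcard := Finset.card_add_card_compl T
  rw [hcard] at hle
  have hle' : (T.card : ℝ) * Tᶜ.card ≤
      ((Fintype.card ι / 2 * ((Fintype.card ι + 1) / 2) : ℕ) : ℝ) := by exact_mod_cast hle
  have hcard' : (T.card : ℝ) + Tᶜ.card = Fintype.card ι := by exact_mod_cast hcard
  have h1 := hsum (fun z => z)
  have h2 := hsum (fun z => z ^ 2)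
  calc Fintype.card ι * ∑ i, x i ^ 2 - (∑ i, x i) ^ 2
      ≤ Fintype.card ι * ∑ i, y i ^ 2 - (∑ i, y i) ^ 2 := by linarith
    _ = T.card * Tᶜ.card * (b - a) ^ 2 := by rw [h1, h2, ← hcard']; ring
    _ ≤ _ := by gcongr

theorem sub_sq_le_two_mul_sum_sq {ι : Type*} [Fintype ι] (x : ι → ℝ) (i j : ι) :
    (x i - x j) ^ 2 ≤ 2 * ∑ k, x k ^ 2 := by
  classical
  rcases eq_or_ne i j with rfl | hij
  · simpa using Finset.sum_nonneg fun k _ => sq_nonneg (x k)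
  · have h := Finset.sum_le_sum_of_subset_of_nonneg (Finset.subset_univ {i, j})
      fun k _ _ => sq_nonneg (x k)
    rw [Finset.sum_pair hij] at h
    nlinarith [sq_nonneg (x i + x j)]

/-- spectral gap bounds for a traceless Frobenius-unit symmetric matrix. -/
theorem stmt12 (n : ℕ) (hn : 2 ≤ n)
    (A : Matrix (Fin n) (Fin n) ℝ) (hAs : Aᵀ = A) (hA : A.IsHermitian)
    (htr : A.trace = 0) (hfro : Matrix.trace (A * A) = 1) :
    Real.sqrt ((n : ℝ) / (((n / 2) * ((n + 1) / 2) : ℕ) : ℝ)) ≤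
      (⨆ k, hA.eigenvalues k) - (⨅ k, hA.eigenvalues k) ∧
    (⨆ k, hA.eigenvalues k) - (⨅ k, hA.eigenvalues k) ≤ Real.sqrt 2 := by
  have : Nonempty (Fin n) := ⟨⟨0, by omega⟩⟩
  have hsum : ∑ i, hA.eigenvalues i = 0 := by simpa [htr] using hA.trace_eq_sum_eigenvalues.symm
  have hsq : ∑ i, hA.eigenvalues i ^ 2 = 1 := by
    rw [← hA.trace_mul_self_eq_sum_sq_eigenvalues, hfro]
  have hmem (k : Fin n) :
      hA.eigenvalues k ∈ Set.Icc (⨅ k, hA.eigenvalues k) (⨆ k, hA.eigenvalues k) :=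
    ⟨ciInf_le (Set.finite_range _).bddBelow k, le_ciSup (Set.finite_range _).bddAbove k⟩
  constructor
  · have hpos : (0 : ℝ) < ((n / 2 * ((n + 1) / 2) : ℕ) : ℝ) := by
      exact_mod_cast Nat.mul_pos (by omega) (by omega)
    have h := card_mul_sum_sq_sub_sq_sum_le hmem
    rw [hsum, hsq, Fintype.card_fin] at h
    refine Real.sqrt_le_iff.2 ⟨?_, ?_⟩
    · have h0 := hmem (Classical.arbitrary _)
      exact sub_nonneg.2 (h0.1.trans h0.2)
    · rw [div_le_iff₀' hpos]
      linarith
  · obtain ⟨i, hi⟩ := exists_eq_ciSup_of_finite (f := hA.eigenvalues)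
    obtain ⟨j, hj⟩ := exists_eq_ciInf_of_finite (f := hA.eigenvalues)
    rw [← hi, ← hj]
    have h := sub_sq_le_two_mul_sum_sq hA.eigenvalues i j
    rw [hsq, mul_one] at h
    exact Real.le_sqrt_of_sq_le h
end

section
/- For every y ∈ ℝ^m, the Euclidean distance from b to the moment body ℳ is at most the norm of the gradient of f at y: Metric.infDist b ℳ ≤ ‖∇f(y)‖₂. In particular, if ‖∇f(y)‖₂ ≤ ε then b lies within distance ε of ℳ. -/
open Matrix Filter
open scoped RealInnerProductSpace

open scoped Topology

/-- For a tracial functional `τ` on a Banach algebra, the derivative of `τ ∘ exp` at `x` is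
`h ↦ τ (exp x * h)`, even when `h` does not commute with `x`. -/
theorem hasFDerivAt_tracial_exp {𝔸 : Type*} [NormedRing 𝔸] [NormedAlgebra ℝ 𝔸]
    [CompleteSpace 𝔸] (τ : 𝔸 →L[ℝ] ℝ) (hτ : ∀ a b, τ (a * b) = τ (b * a)) (x : 𝔸) :
    HasFDerivAt (fun z : 𝔸 => τ (NormedSpace.exp z))
      (τ ∘L ContinuousLinearMap.mul ℝ 𝔸 (NormedSpace.exp x)) x := by
  let _ : NormedAlgebra ℚ 𝔸 := .restrictScalars ℚ ℝ 𝔸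
  have hd (z : 𝔸) : DifferentiableAt ℝ (NormedSpace.exp : 𝔸 → 𝔸) z :=
    (NormedSpace.exp_analytic (𝕂 := ℝ) z).differentiableAt
  have hc : ContDiff ℝ 1 (NormedSpace.exp : 𝔸 → 𝔸) :=
    contDiff_iff_contDiffAt.2 fun z => (NormedSpace.exp_analytic (𝕂 := ℝ) z).contDiffAt
  have hcont : Continuous (fderiv ℝ (NormedSpace.exp : 𝔸 → 𝔸)) := hc.continuous_fderiv one_ne_zero
  have hcomp : HasFDerivAt (fun z : 𝔸 => τ (NormedSpace.exp z))
      (τ ∘L fderiv ℝ NormedSpace.exp x) x := τ.hasFDerivAt.comp x (hd x).hasFDerivAt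
  convert hcomp using 1
  ext h
  have key (N : ℕ) : τ (fderiv ℝ NormedSpace.exp x h) =
      τ (NormedSpace.exp ((1 - 1 / ((N : ℝ) + 1)) • x) *
        fderiv ℝ NormedSpace.exp ((1 / ((N : ℝ) + 1)) • x) h) := by
    have hN : (N : ℝ) + 1 ≠ 0 := by positivity
    set c : ℝ := 1 / ((N : ℝ) + 1) with hcdef
    have hpow : (fun z : 𝔸 => τ (NormedSpace.exp z)) =
        fun z : 𝔸 => τ (NormedSpace.exp (c • z) ^ (N + 1)) := by
      funext z
      rw [← NormedSpace.exp_nsmul, ← Nat.cast_smul_eq_nsmul ℝ, smul_smul]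
      simp [hcdef, hN]
    have h1 : HasFDerivAt (fun z : 𝔸 => NormedSpace.exp (c • z))
        ((fderiv ℝ NormedSpace.exp (c • x)) ∘L (c • ContinuousLinearMap.id ℝ 𝔸)) x :=
      HasFDerivAt.comp x (hd (c • x)).hasFDerivAt ((hasFDerivAt_id x).const_smul c)
    have h2 := τ.hasFDerivAt.comp x (h1.pow' (N + 1))
    rw [hpow] at hcomp
    have h3 := DFunLike.congr_fun (hcomp.unique h2) h
    have hexp : NormedSpace.exp (c • x) ^ N = NormedSpace.exp ((1 - c) • x) := by
      rw [← NormedSpace.exp_nsmul, ← Nat.cast_smul_eq_nsmul ℝ, smul_smul]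
      congr 2
      rw [hcdef]
      field_simp
      ring
    have hterm (i : ℕ) (hi : i ∈ Finset.range (N + 1)) (d : 𝔸) :
        τ (NormedSpace.exp (c • x) ^ (N - i) * d * NormedSpace.exp (c • x) ^ i) =
          τ (NormedSpace.exp ((1 - c) • x) * d) := by
      rw [hτ, ← mul_assoc, ← pow_add,
        Nat.add_sub_cancel' (Nat.lt_succ_iff.1 (Finset.mem_range.1 hi)), hexp]
    simp only [ContinuousLinearMap.comp_apply] at h3
    rw [h3]
    suffices ∑ i ∈ Finset.range (N + 1),
        c * τ (NormedSpace.exp (c • x) ^ (N - i) * fderiv ℝ NormedSpace.exp (c • x) h *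
          NormedSpace.exp (c • x) ^ i) =
        τ (NormedSpace.exp ((1 - c) • x) * fderiv ℝ NormedSpace.exp (c • x) h) by
      simpa [map_sum] using this
    rw [Finset.sum_congr rfl fun i hi => by rw [hterm i hi], Finset.sum_const, Finset.card_range,
      nsmul_eq_mul, ← mul_assoc, Nat.cast_add_one, hcdef, mul_one_div_cancel hN, one_mul]
  have hlim : Tendsto (fun N : ℕ => 1 / ((N : ℝ) + 1)) atTop (𝓝 0) :=
    tendsto_one_div_add_atTop_nhds_zero_nat
  have hexpc : Continuous (NormedSpace.exp : 𝔸 → 𝔸) := hc.continuous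
  have hφ : Continuous fun c : ℝ => τ (NormedSpace.exp ((1 - c) • x) *
      fderiv ℝ NormedSpace.exp (c • x) h) := by fun_prop
  have hlim2 := (hφ.tendsto 0).comp hlim
  have hlim3 := tendsto_nhds_unique
    (tendsto_const_nhds.congr (fun N => key N)) hlim2
  have h0 : fderiv ℝ (NormedSpace.exp : 𝔸 → 𝔸) 0 = 1 :=
    (hasFDerivAt_exp_zero (𝕂 := ℝ) (𝔸 := 𝔸)).fderiv
  simpa [h0] using hlim3.symm

open scoped Matrix.Norms.Operator in
theorem hasFDerivAt_trace_exp_matA {n m : ℕ} (A : Fin m → Matrix (Fin n) (Fin n) ℝ)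
    (y : EuclideanSpace ℝ (Fin m)) :
    ∃ L : EuclideanSpace ℝ (Fin m) →L[ℝ] ℝ,
      (∀ h, L h = (NormedSpace.exp (matA A y) * matA A h).trace) ∧
      HasFDerivAt (fun z => (NormedSpace.exp (matA A z)).trace) L y := by
  let T : EuclideanSpace ℝ (Fin m) →ₗ[ℝ] Matrix (Fin n) (Fin n) ℝ :=
    { toFun := matA A
      map_add' := fun u v => by simp [matA, add_smul, Finset.sum_add_distrib]
      map_smul' := fun c u => by simp [matA, mul_smul, Finset.smul_sum] }
  have hT : HasFDerivAt (matA A) (LinearMap.toContinuousLinearMap T) y :=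
    (LinearMap.toContinuousLinearMap T).hasFDerivAt
  exact ⟨_, fun _ => rfl, (hasFDerivAt_tracial_exp
    (LinearMap.toContinuousLinearMap (Matrix.traceLinearMap (Fin n) ℝ ℝ))
    (fun a b => Matrix.trace_mul_comm a b) (matA A y)).comp y hT⟩

theorem posDef_exp_of_isSymm {n : ℕ} {X : Matrix (Fin n) (Fin n) ℝ} (hX : X.IsSymm) :
    (NormedSpace.exp X).PosDef := by
  have hhalf : (NormedSpace.exp ((1 / 2 : ℝ) • X)).IsSymm := (hX.smul _).exp
  have hmul : NormedSpace.exp X =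
      (NormedSpace.exp ((1 / 2 : ℝ) • X))ᴴ * NormedSpace.exp ((1 / 2 : ℝ) • X) := by
    rw [conjTranspose_eq_transpose_of_trivial, hhalf.eq,
      ← Matrix.exp_add_of_commute _ _ (Commute.refl _), ← add_smul]
    norm_num
  rw [hmul]
  exact PosDef.conjTranspose_mul_self _
    (Matrix.mulVec_injective_of_isUnit (Matrix.isUnit_exp _))

theorem isSymm_matA {n m : ℕ} {A : Fin m → Matrix (Fin n) (Fin n) ℝ}
    (hA : ∀ i, (A i)ᵀ = A i) (y : EuclideanSpace ℝ (Fin m)) : (matA A y).IsSymm := by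
  simp [Matrix.IsSymm, matA, Matrix.transpose_sum, hA]

theorem trace_exp_matA_pos {n m : ℕ} (hn : 1 ≤ n) {A : Fin m → Matrix (Fin n) (Fin n) ℝ}
    (hA : ∀ i, (A i)ᵀ = A i) (y : EuclideanSpace ℝ (Fin m)) :
    0 < (NormedSpace.exp (matA A y)).trace :=
  have : Nonempty (Fin n) := ⟨⟨0, hn⟩⟩
  (posDef_exp_of_isSymm (isSymm_matA hA y)).trace_pos

theorem densityMat_mem_spectraplex {n m : ℕ} (hn : 1 ≤ n)
    {A : Fin m → Matrix (Fin n) (Fin n) ℝ} (hA : ∀ i, (A i)ᵀ = A i)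
    (y : EuclideanSpace ℝ (Fin m)) : densityMat A y ∈ spectraplex n := by
  have hpos := trace_exp_matA_pos hn hA y
  refine ⟨(isSymm_matA hA y).exp.smul _,
    (posDef_exp_of_isSymm (isSymm_matA hA y)).posSemidef.smul (inv_nonneg.2 hpos.le), ?_⟩
  rw [densityMat, Matrix.trace_smul, smul_eq_mul, inv_mul_cancel₀ hpos.ne']

theorem hasGradientAt_logPart {n m : ℕ} (hn : 1 ≤ n)
    {A : Fin m → Matrix (Fin n) (Fin n) ℝ} (hA : ∀ i, (A i)ᵀ = A i)
    (b y : EuclideanSpace ℝ (Fin m)) :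
    HasGradientAt (logPart A b) (Amap A (densityMat A y) - b) y := by
  obtain ⟨L, hL, hd⟩ := hasFDerivAt_trace_exp_matA A y
  have hlog := (hd.log (trace_exp_matA_pos hn hA y).ne').sub (innerSL ℝ b).hasFDerivAt
  rw [hasGradientAt_iff_hasFDerivAt]
  refine hlog.congr_fderiv ?_
  ext h
  simp only [_root_.sub_apply, _root_.smul_apply, hL,
    InnerProductSpace.toDual_apply_apply, inner_sub_left, innerSL_apply_apply, sub_left_inj]
  simp [PiLp.inner_apply, Amap, densityMat, matA, Matrix.trace_sum,
    Finset.mul_sum, mul_left_comm, Matrix.trace_mul_comm (NormedSpace.exp _)]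

/-- the gradient norm bounds the distance from b to the moment body. -/
theorem stmt17 (n m : ℕ) (hn : 1 ≤ n)
    (A : Fin m → Matrix (Fin n) (Fin n) ℝ) (hA : ∀ i, (A i)ᵀ = A i)
    (b : EuclideanSpace ℝ (Fin m)) :
    ∀ y : EuclideanSpace ℝ (Fin m),
      Metric.infDist b (momentBody A) ≤ ‖gradient (logPart A b) y‖ ∧
      ∀ ε : ℝ, ‖gradient (logPart A b) y‖ ≤ ε → Metric.infDist b (momentBody A) ≤ ε := by
  intro y
  have hle : Metric.infDist b (momentBody A) ≤ ‖gradient (logPart A b) y‖ := by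
    rw [(hasGradientAt_logPart hn hA b y).gradient, ← dist_eq_norm, dist_comm]
    exact Metric.infDist_le_dist_of_mem ⟨_, densityMat_mem_spectraplex hn hA y, rfl⟩
  exact ⟨hle, fun ε hε => hle.trans hε⟩
end

section
/- If f(y) < 0 for some y ∈ ℝ^m, then ⟨b, y⟩ > λ_max(A(y)) (so the hyperplane with normal y strictly separates b from the moment body) and consequently b ∉ ℳ. -/
open Matrix Filter
open scoped RealInnerProductSpace

/-- The trace of the exponential of a real symmetric matrix is the sum of the exponentials of its
eigenvalues. -/
theorem Matrix.IsHermitian.trace_exp_eq_sum {ι : Type*} [Fintype ι] [DecidableEq ι]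
    {M : Matrix ι ι ℝ} (hM : M.IsHermitian) :
    (NormedSpace.exp M).trace = ∑ i, Real.exp (hM.eigenvalues i) := by
  have hU : IsUnit (hM.eigenvectorUnitary : Matrix ι ι ℝ) :=
    (Unitary.toUnits hM.eigenvectorUnitary).isUnit
  have hinv : star (hM.eigenvectorUnitary : Matrix ι ι ℝ) =
      (hM.eigenvectorUnitary : Matrix ι ι ℝ)⁻¹ :=
    (Matrix.inv_eq_left_inv (Unitary.coe_star_mul_self hM.eigenvectorUnitary)).symm
  have hdet := (Matrix.isUnit_iff_isUnit_det _).mp hU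
  conv_lhs => rw [hM.spectral_theorem, Unitary.conjStarAlgAut_apply, hinv, Matrix.exp_conj _ _ hU,
    Matrix.trace_mul_comm, ← mul_assoc, Matrix.nonsing_inv_mul _ hdet, one_mul,
    Matrix.exp_diagonal, Matrix.trace_diagonal]
  simp [Pi.coe_exp, Real.exp_eq_exp_ℝ]

/-- Pairing a real symmetric matrix with a positive semidefinite matrix of trace one gives at most
any upper bound on its eigenvalues. -/
theorem Matrix.IsHermitian.trace_mul_le {ι : Type*} [Fintype ι] [DecidableEq ι]
    {M X : Matrix ι ι ℝ} (hM : M.IsHermitian) (hX : X.PosSemidef) {c : ℝ}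
    (hc : ∀ i, hM.eigenvalues i ≤ c) : (M * X).trace ≤ c * X.trace := by
  set U := (hM.eigenvectorUnitary : Matrix ι ι ℝ) with hUdef
  have hUU : U * star U = 1 := Unitary.coe_mul_star_self hM.eigenvectorUnitary
  have hP : (star U * X * U).PosSemidef := hX.conjTranspose_mul_mul_same U
  have htr : (star U * X * U).trace = X.trace := by
    rw [Matrix.trace_mul_comm, ← mul_assoc, hUU, one_mul]
  have hMX : (M * X).trace = ∑ i, hM.eigenvalues i * (star U * X * U) i i := by
    conv_lhs => rw [hM.spectral_theorem, Unitary.conjStarAlgAut_apply, ← hUdef, mul_assoc U,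
      mul_assoc U, Matrix.trace_mul_comm, mul_assoc, mul_assoc, ← mul_assoc _ X U]
    simp [Matrix.trace, Matrix.diagonal_mul]
  rw [hMX, ← htr, Matrix.trace, Finset.mul_sum]
  exact Finset.sum_le_sum fun i _ => mul_le_mul_of_nonneg_right (hc i) hP.diag_nonneg

/-- The adjoint relation between `Amap` and `matA`. -/
theorem inner_Amap {n m : ℕ} (A : Fin m → Matrix (Fin n) (Fin n) ℝ)
    (X : Matrix (Fin n) (Fin n) ℝ) (y : EuclideanSpace ℝ (Fin m)) :
    ⟪Amap A X, y⟫ = (matA A y * X).trace := by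
  simp [Amap, matA, PiLp.inner_apply, Finset.sum_mul, Matrix.trace_sum]

/-- a negative value of f certifies infeasibility. -/
theorem stmt18 (n m : ℕ) (hn : 1 ≤ n)
    (A : Fin m → Matrix (Fin n) (Fin n) ℝ) (hA : ∀ i, (A i)ᵀ = A i)
    (b : EuclideanSpace ℝ (Fin m)) (y : EuclideanSpace ℝ (Fin m))
    (hH : (matA A y).IsHermitian)
    (hneg : logPart A b y < 0) :
    (⨆ k, hH.eigenvalues k) < ⟪b, y⟫ ∧ b ∉ momentBody A := by
  have hlt : (⨆ k, hH.eigenvalues k) < ⟪b, y⟫ := by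
    have : Nonempty (Fin n) := ⟨⟨0, hn⟩⟩
    refine lt_of_le_of_lt (ciSup_le fun k => ?_) (sub_neg.mp hneg)
    rw [hH.trace_exp_eq_sum]
    have hk : Real.exp (hH.eigenvalues k) ≤ ∑ i, Real.exp (hH.eigenvalues i) :=
      Finset.single_le_sum (fun i _ => (Real.exp_pos (hH.eigenvalues i)).le) (Finset.mem_univ k)
    exact (Real.le_log_iff_exp_le ((Real.exp_pos _).trans_le hk)).mpr hk
  refine ⟨hlt, ?_⟩
  rintro ⟨X, ⟨-, hX, hX1⟩, rfl⟩
  have hle := hH.trace_mul_le hX fun k => le_ciSup (Set.finite_range hH.eigenvalues).bddAbove k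
  rw [hX1, mul_one, ← inner_Amap] at hle
  exact hlt.not_ge hle
end
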